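/- arXiv:2307.10754 — 4 statements merged into one kernel-verified Lean document; each statement's English description precedes it below -/
import Mathlib

section
/- Let ℓ ∈ [1,2] and let X₁, …, Xₙ be independent real-valued random variables on a probability space with E[Xᵢ] = 0 and E[|Xᵢ|^ℓ] < ∞ for each i. Then E[|X₁ + ⋯ + Xₙ|^ℓ] ≤ 2 · (E[|X₁|^ℓ] + ⋯ + E[|Xₙ|^ℓ]). -/
open MeasureTheory ProbabilityTheory

lemma abs_rpow_sub_two_mul_of_nonneg {p x : ℝ} (hp : 1 < p) (hx : 0 ≤ x) :
    |x| ^ (p - 2) * x = x ^ (p - 1) := by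
  rcases hx.eq_or_lt with rfl | hx
  · simp [Real.zero_rpow (sub_pos.2 hp).ne']
  · rw [abs_of_pos hx, ← Real.rpow_add_one hx.ne']
    ring_nf

lemma abs_rpow_sub_two_mul_of_nonpos {p x : ℝ} (hp : 1 < p) (hx : x ≤ 0) :
    |x| ^ (p - 2) * x = -(-x) ^ (p - 1) := by
  rw [← abs_rpow_sub_two_mul_of_nonneg hp (neg_nonneg.2 hx), abs_neg, mul_neg, neg_neg]

lemma abs_abs_rpow_sub_two_mul_le {p : ℝ} (hp : 1 ≤ p) (hp2 : p ≤ 2) (x : ℝ) :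
    |(|x| ^ (p - 2) * x)| ≤ 1 + |x| := by
  rcases eq_or_ne x 0 with rfl | hx
  · simp
  have hx' : 0 < |x| := abs_pos.2 hx
  rw [abs_mul, abs_of_nonneg (Real.rpow_nonneg hx'.le _), ← Real.rpow_add_one hx'.ne']
  rcases le_total |x| 1 with h | h
  · linarith [Real.rpow_le_one hx'.le h (by linarith : 0 ≤ p - 2 + 1)]
  · linarith [Real.rpow_le_self_of_one_le h (by linarith : p - 2 + 1 ≤ 1)]

/-- The function `t ↦ |t| ^ (p - 2) * t` is one-sidedly Hölder of exponent `p - 1`. -/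
lemma abs_rpow_sub_two_mul_add_le {p : ℝ} (hp : 1 < p) (hp2 : p ≤ 2) (x : ℝ) {s : ℝ}
    (hs : 0 ≤ s) :
    |x + s| ^ (p - 2) * (x + s) ≤ |x| ^ (p - 2) * x + 2 * s ^ (p - 1) := by
  have hp0 : 0 ≤ p - 1 := by linarith
  have hs' : 0 ≤ s ^ (p - 1) := Real.rpow_nonneg hs _
  rcases le_total 0 x with hx | hx
  · rw [abs_rpow_sub_two_mul_of_nonneg hp hx, abs_rpow_sub_two_mul_of_nonneg hp (by positivity)]
    linarith [Real.rpow_add_le_add_rpow hx hs hp0 (by linarith)]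
  rw [abs_rpow_sub_two_mul_of_nonpos hp hx]
  rcases le_total 0 (x + s) with hxs | hxs
  · rw [abs_rpow_sub_two_mul_of_nonneg hp hxs]
    linarith [Real.rpow_le_rpow hxs (by linarith : x + s ≤ s) hp0,
      Real.rpow_le_rpow (neg_nonneg.2 hx) (by linarith : -x ≤ s) hp0]
  · rw [abs_rpow_sub_two_mul_of_nonpos hp hxs]
    have h := Real.rpow_add_le_add_rpow (neg_nonneg.2 hxs) hs hp0 (by linarith)
    rw [show -(x + s) + s = -x by ring] at h
    linarith

lemma abs_add_rpow_le_of_nonneg {p : ℝ} (hp : 1 < p) (hp2 : p ≤ 2) (x : ℝ) {y : ℝ}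
    (hy : 0 ≤ y) :
    |x + y| ^ p ≤ |x| ^ p + p * (|x| ^ (p - 2) * x * y) + 2 * |y| ^ p := by
  have hderiv (t : ℝ) : HasDerivAt
      (fun t ↦ p * (|x| ^ (p - 2) * x * t) + 2 * |t| ^ p - |x + t| ^ p)
      (p * (|x| ^ (p - 2) * x * 1) + 2 * (p * |t| ^ (p - 2) * t)
        - p * |x + t| ^ (p - 2) * (x + t)) t :=
    ((((hasDerivAt_id t).const_mul _).const_mul p).add
      ((hasDerivAt_abs_rpow t hp).const_mul 2)).sub
      ((hasDerivAt_abs_rpow (x + t) hp).comp_const_add x t)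
  have hmono : MonotoneOn
      (fun t ↦ p * (|x| ^ (p - 2) * x * t) + 2 * |t| ^ p - |x + t| ^ p) (Set.Ici 0) := by
    refine monotoneOn_of_deriv_nonneg (convex_Ici 0)
      (fun t _ ↦ (hderiv t).continuousAt.continuousWithinAt)
      (fun t _ ↦ (hderiv t).differentiableAt.differentiableWithinAt) fun t ht ↦ ?_
    have ht0 : 0 ≤ t := interior_subset ht
    rw [(hderiv t).deriv]
    have h := mul_le_mul_of_nonneg_left (abs_rpow_sub_two_mul_add_le hp hp2 x ht0)
      (by linarith : 0 ≤ p)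
    rw [← abs_rpow_sub_two_mul_of_nonneg hp ht0] at h
    linarith
  have h := hmono Set.self_mem_Ici hy hy
  simp only [mul_zero, abs_zero, add_zero, Real.zero_rpow (by linarith : p ≠ 0)] at h
  linarith

/-- A first-order Taylor bound for `|·| ^ p`, `1 ≤ p ≤ 2`. -/
lemma abs_add_rpow_le {p : ℝ} (hp : 1 ≤ p) (hp2 : p ≤ 2) (x y : ℝ) :
    |x + y| ^ p ≤ |x| ^ p + p * (|x| ^ (p - 2) * x * y) + 2 * |y| ^ p := by
  rcases hp.eq_or_lt with rfl | hp
  · have h : |(|x| ^ ((1 : ℝ) - 2) * x)| ≤ 1 := by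
      rw [show (1 : ℝ) - 2 = -1 by norm_num, Real.rpow_neg_one, abs_mul, abs_inv, abs_abs]
      exact inv_mul_le_one
    have h' : |(|x| ^ ((1 : ℝ) - 2) * x * y)| ≤ |y| := by
      rw [abs_mul]
      exact mul_le_of_le_one_left (abs_nonneg y) h
    simp only [Real.rpow_one, one_mul]
    linarith [neg_le_of_abs_le h', abs_add_le x y]
  rcases le_total 0 y with hy | hy
  · exact abs_add_rpow_le_of_nonneg hp hp2 x hy
  · have h := abs_add_rpow_le_of_nonneg hp hp2 (-x) (neg_nonneg.2 hy)
    rwa [← neg_add, abs_neg, abs_neg, abs_neg, mul_assoc, neg_mul_neg,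
      ← mul_assoc (|x| ^ (p - 2))] at h

/-- Adding an independent centered variable `Y` to `S` increases the `p`-th absolute moment by at
most twice that of `Y`. -/
lemma integral_abs_add_rpow_le {Ω : Type*} [MeasurableSpace Ω] {μ : Measure Ω}
    [IsProbabilityMeasure μ] {p : ℝ} (hp : 1 ≤ p) (hp2 : p ≤ 2) {S Y : Ω → ℝ}
    (hSY : IndepFun S Y μ) (hS : Integrable S μ) (hY : Integrable Y μ)
    (hY0 : ∫ ω, Y ω ∂μ = 0) (hSp : Integrable (fun ω ↦ |S ω| ^ p) μ)
    (hYp : Integrable (fun ω ↦ |Y ω| ^ p) μ) :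
    Integrable (fun ω ↦ |S ω + Y ω| ^ p) μ ∧
      ∫ ω, |S ω + Y ω| ^ p ∂μ ≤ ∫ ω, |S ω| ^ p ∂μ + 2 * ∫ ω, |Y ω| ^ p ∂μ := by
  have hg : Measurable fun x : ℝ ↦ |x| ^ (p - 2) * x := by fun_prop
  have hSm := hS.aestronglyMeasurable.aemeasurable
  have hYm := hY.aestronglyMeasurable.aemeasurable
  have hgS : Integrable (fun ω ↦ |S ω| ^ (p - 2) * S ω) μ :=
    ((integrable_const 1).add hS.abs).mono' (hg.comp_aemeasurable hSm).aestronglyMeasurable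
      (ae_of_all _ fun ω ↦ abs_abs_rpow_sub_two_mul_le hp hp2 (S ω))
  have hind : IndepFun (fun ω ↦ |S ω| ^ (p - 2) * S ω) Y μ := hSY.comp hg measurable_id
  have hgSY : Integrable (fun ω ↦ |S ω| ^ (p - 2) * S ω * Y ω) μ := hind.integrable_mul hgS hY
  have hgSY0 : ∫ ω, |S ω| ^ (p - 2) * S ω * Y ω ∂μ = 0 := by
    rw [hind.integral_fun_mul_eq_mul_integral hgS.aestronglyMeasurable hY.aestronglyMeasurable,
      hY0, mul_zero]
  have hle (ω : Ω) := abs_add_rpow_le hp hp2 (S ω) (Y ω)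
  have hlin := hSp.add (hgSY.const_mul p)
  have hbound := hlin.add (hYp.const_mul 2)
  have hsum : Integrable (fun ω ↦ |S ω + Y ω| ^ p) μ := by
    refine hbound.mono' (AEMeasurable.aestronglyMeasurable (by fun_prop)) (ae_of_all _ fun ω ↦ ?_)
    rw [Real.norm_of_nonneg (by positivity)]
    exact hle ω
  refine ⟨hsum, (integral_mono hsum hbound hle).trans_eq ?_⟩
  rw [integral_add' hlin (hYp.const_mul 2), integral_add' hSp (hgSY.const_mul p),
    integral_const_mul, integral_const_mul, hgSY0, mul_zero, add_zero]

/-- **von Bahr–Esseen inequality.** For `ℓ ∈ [1,2]` and independent centered real random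
variables `X₁, …, Xₙ` with `E[|Xᵢ|^ℓ] < ∞`, one has
`E[|X₁ + ⋯ + Xₙ|^ℓ] ≤ 2 (E[|X₁|^ℓ] + ⋯ + E[|Xₙ|^ℓ])`. -/
theorem von_bahr_esseen {Ω : Type*} [MeasurableSpace Ω] (μ : Measure Ω)
    [IsProbabilityMeasure μ] (ℓ : ℝ) (hℓ : ℓ ∈ Set.Icc (1 : ℝ) 2)
    (n : ℕ) (X : Fin n → Ω → ℝ)
    (hmeas : ∀ i, Measurable (X i))
    (hindep : iIndepFun X μ)
    (hint : ∀ i, Integrable (X i) μ)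
    (hcent : ∀ i, ∫ ω, X i ω ∂μ = 0)
    (hmom : ∀ i, Integrable (fun ω => |X i ω| ^ ℓ) μ) :
    ∫ ω, |∑ i, X i ω| ^ ℓ ∂μ ≤ 2 * ∑ i, ∫ ω, |X i ω| ^ ℓ ∂μ := by
  have key (s : Finset (Fin n)) : Integrable (fun ω ↦ |∑ i ∈ s, X i ω| ^ ℓ) μ ∧
      ∫ ω, |∑ i ∈ s, X i ω| ^ ℓ ∂μ ≤ 2 * ∑ i ∈ s, ∫ ω, |X i ω| ^ ℓ ∂μ := by
    induction s using Finset.induction_on with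
    | empty => simp [Real.zero_rpow (by linarith [hℓ.1] : ℓ ≠ 0)]
    | insert a s ha ih =>
      have hind : IndepFun (fun ω ↦ ∑ i ∈ s, X i ω) (X a) μ := by
        simpa only [Finset.sum_fn] using hindep.indepFun_finsetSum_of_notMem hmeas ha
      obtain ⟨h₁, h₂⟩ := integral_abs_add_rpow_le hℓ.1 hℓ.2 hind
        (integrable_finsetSum s fun i _ ↦ hint i) (hint a) (hcent a) ih.1 (hmom a)
      simp only [Finset.sum_insert ha, add_comm (X a _)]
      exact ⟨h₁, by linarith [ih.2]⟩
  exact (key Finset.univ).2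
end

section
/- Let H_k denote the k-th probabilist's Hermite polynomial and φ(x) = (1/√(2π)) e^{−x²/2} the standard Gaussian density. Then for every integer k ≥ 1 and every y ∈ ℝ, |φ(y) H_k(y)| ≤ √(2/π) · √(k!) · e^{−y²/4} ≤ √(2/π) · √(k!). -/
open Real Finset

/-- The standard Gaussian density `φ(x) = (1/√(2π)) e^{−x²/2}`. -/
noncomputable def stdGaussianPDF (x : ℝ) : ℝ := (1 / Real.sqrt (2 * π)) * Real.exp (-x ^ 2 / 2)

/-- The `k`-th probabilist's Hermite polynomial, given by its explicit expansion:
`H_k(x) = Σ_{j=0}^{⌊k/2⌋} k! (−1)^j / (2^j j! (k−2j)!) x^{k−2j}` (with `H₀ = 1`). -/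
noncomputable def hermiteP (k : ℕ) (x : ℝ) : ℝ :=
  ∑ j ∈ Finset.range (k / 2 + 1),
    ((k.factorial : ℝ) * (-1 : ℝ) ^ j /
        (2 ^ j * (j.factorial : ℝ) * ((k - 2 * j).factorial : ℝ))) * x ^ (k - 2 * j)

open Polynomial in
theorem coeff_hermite_two_mul_add (j m : ℕ) :
    ((coeff (hermite (2 * j + m)) m : ℤ) : ℝ) =
      ((2 * j + m).factorial : ℝ) * (-1) ^ j / (2 ^ j * j.factorial * m.factorial) := by
  have hdf : ((2 * j).factorial : ℝ) =
      (Nat.doubleFactorial (2 * j - 1) : ℝ) * (2 ^ j * j.factorial) := by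
    rcases j with _ | j
    · simp
    · have h := Nat.factorial_eq_mul_doubleFactorial (2 * j + 1)
      rw [show 2 * j + 1 + 1 = 2 * (j + 1) by ring, Nat.doubleFactorial_two_mul] at h
      rw [show 2 * (j + 1) - 1 = 2 * j + 1 by lia, h]
      push_cast
      ring
  rw [coeff_hermite_explicit]
  push_cast
  rw [Nat.cast_choose ℝ (Nat.le_add_left m (2 * j)), Nat.add_sub_cancel, hdf]
  have hd : (Nat.doubleFactorial (2 * j - 1) : ℝ) ≠ 0 := by
    exact_mod_cast (Nat.doubleFactorial_pos _).ne'
  field_simp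

open Polynomial in
theorem hermiteP_eq_aeval (k : ℕ) (x : ℝ) : hermiteP k x = aeval x (hermite k) := by
  rw [aeval_eq_sum_range, natDegree_hermite, ← Finset.sum_range_reflect]
  unfold hermiteP
  refine Finset.sum_bij_ne_zero (fun j _ _ => 2 * j) ?_ ?_ ?_ ?_
  · intro j hj _
    simp only [Finset.mem_range] at hj ⊢
    lia
  · intro i _ _ j _ _ h
    lia
  · intro i hi hne
    simp only [Finset.mem_range] at hi
    have heven : Even i := by
      by_contra hodd
      apply hne
      rw [coeff_hermite_of_odd_add, zero_smul]
      rw [Nat.not_even_iff_odd] at hodd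
      obtain ⟨m, rfl⟩ := hodd
      exact ⟨k - m - 1, by lia⟩
    obtain ⟨j, rfl⟩ := heven.two_dvd
    refine ⟨j, by simp only [Finset.mem_range]; lia, ?_, rfl⟩
    intro h0
    apply hne
    obtain ⟨m, rfl⟩ : ∃ m, k = 2 * j + m := ⟨k - 2 * j, by lia⟩
    rw [show 2 * j + m + 1 - 1 - 2 * j = m by lia, zsmul_eq_mul, coeff_hermite_two_mul_add]
    simpa using h0
  · intro j hj _
    simp only [Finset.mem_range] at hj
    obtain ⟨m, rfl⟩ : ∃ m, k = 2 * j + m := ⟨k - 2 * j, by lia⟩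
    rw [show 2 * j + m + 1 - 1 - 2 * j = m by lia, zsmul_eq_mul, coeff_hermite_two_mul_add]
    simp

open Polynomial in
theorem iteratedDeriv_hermite_generating_function (w : ℂ) (n : ℕ) :
    iteratedDeriv n (fun z : ℂ => Complex.exp (w * z - z ^ 2 / 2)) =
      fun z => aeval (w - z) (hermite n) * Complex.exp (w * z - z ^ 2 / 2) := by
  induction n with
  | zero => simp
  | succ n ih =>
    rw [iteratedDeriv_succ, ih]
    funext z
    have hp : HasDerivAt (fun z : ℂ => aeval (w - z) (hermite n))
        (aeval (w - z) (derivative (hermite n)) * -1) z :=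
      ((hermite n).hasDerivAt_aeval (w - z)).comp z (by simpa using (hasDerivAt_id z).const_sub w)
    have he : HasDerivAt (fun z : ℂ => Complex.exp (w * z - z ^ 2 / 2))
        (Complex.exp (w * z - z ^ 2 / 2) * (w * 1 - (2 : ℕ) * z ^ (2 - 1) * 1 / 2)) z :=
      (((hasDerivAt_id z).const_mul w).sub (((hasDerivAt_id z).pow 2).div_const 2)).cexp
    rw [(hp.fun_mul he).deriv, hermite_succ]
    simp only [map_sub, map_mul, aeval_X]
    push_cast
    ring

open Polynomial in
theorem abs_aeval_hermite_le_integral (k : ℕ) (y : ℝ) {R : ℝ} (hR : 0 < R) :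
    |aeval y (hermite k)| ≤ k.factorial * rexp (y ^ 2 / 4 + R ^ 2 / 2) / (2 * π * R ^ k) *
      ∫ θ in (0 : ℝ)..2 * π, rexp (-(R * cos θ - y / 2) ^ 2) := by
  set f : ℂ → ℂ := fun z => Complex.exp (y * z - z ^ 2 / 2) with hf
  have hdiff : Differentiable ℂ f := by fun_prop
  have hcauchy := hdiff.diffContOnCl.circleIntegral_one_div_sub_center_pow_smul
    (c := 0) hR k
  rw [iteratedDeriv_hermite_generating_function] at hcauchy
  have hcast : aeval ((y : ℂ) - 0) (hermite k) = ((aeval y (hermite k) : ℝ) : ℂ) := by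
    rw [sub_zero]
    exact aeval_algebraMap_apply ℂ y (hermite k)
  simp only [hcast, circleIntegral] at hcauchy
  have hnorm : ∀ θ : ℝ, ‖deriv (circleMap 0 R) θ • (1 / (circleMap 0 R θ - 0) ^ (k + 1)) •
      f (circleMap 0 R θ)‖ =
      rexp (y ^ 2 / 4 + R ^ 2 / 2) / R ^ k * rexp (-(R * cos θ - y / 2) ^ 2) := by
    intro θ
    have hre : ((y : ℂ) * circleMap 0 R θ - circleMap 0 R θ ^ 2 / 2).re =
        (y ^ 2 / 4 + R ^ 2 / 2) + -(R * cos θ - y / 2) ^ 2 := by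
      have hs := sin_sq_add_cos_sq θ
      have h2 : circleMap 0 R θ = ((R * cos θ : ℝ) : ℂ) + ((R * sin θ : ℝ) : ℂ) * Complex.I := by
        simp [circleMap, Complex.exp_mul_I]
        ring
      rw [h2]
      simp [pow_two, -Complex.ofReal_mul, -Complex.ofReal_cos, -Complex.ofReal_sin]
      linear_combination (R ^ 2 / 2) * hs
    simp only [hf, norm_smul, Complex.norm_exp, hre, Real.exp_add]
    simp [abs_of_pos hR]
    field_simp
    ring
  have h1 := intervalIntegral.norm_integral_le_integral_norm (μ := MeasureTheory.volume)
    (f := fun θ => deriv (circleMap 0 R) θ • (1 / (circleMap 0 R θ - 0) ^ (k + 1)) •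
      f (circleMap 0 R θ)) two_pi_pos.le
  rw [hcauchy] at h1
  simp only [hnorm, intervalIntegral.integral_const_mul] at h1
  simp [abs_of_pos pi_pos] at h1
  set J := ∫ θ in (0 : ℝ)..2 * π, rexp (-(R * cos θ - y / 2) ^ 2)
  have hk : (0 : ℝ) < k.factorial := by positivity
  have h2 : 2 * π / k.factorial * |aeval y (hermite k)| ≤
      rexp (y ^ 2 / 4 + R ^ 2 / 2) / R ^ k * J := by simpa using h1
  calc |aeval y (hermite k)| =
        (k.factorial / (2 * π)) * (2 * π / k.factorial * |aeval y (hermite k)|) := by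
        field_simp
    _ ≤ (k.factorial / (2 * π)) * (rexp (y ^ 2 / 4 + R ^ 2 / 2) / R ^ k * J) := by gcongr
    _ = _ := by field_simp

theorem one_sub_cos_sub_arccos_le (s : ℝ) {θ : ℝ} (h0 : 0 ≤ θ) (hπ : θ ≤ π) :
    1 - cos (θ - arccos s) ≤ |cos θ - s| := by
  have hprod : 0 ≤ sin θ * sin (arccos s) :=
    mul_nonneg (sin_nonneg_of_nonneg_of_le_pi h0 hπ)
      (sin_nonneg_of_nonneg_of_le_pi (arccos_nonneg s) (arccos_le_pi s))
  rcases le_total s (-1) with hs | hs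
  · rw [arccos_of_le_neg_one hs, cos_sub_pi]
    exact le_trans (by linarith) (le_abs_self _)
  rcases le_total 1 s with hs' | hs'
  · rw [arccos_of_one_le hs', sub_zero]
    exact le_trans (by linarith) (neg_le_abs _)
  rw [cos_sub, cos_arccos hs hs']
  have h1 := neg_one_le_cos θ
  have h2 := cos_le_one θ
  have hsq : (sin θ * sin (arccos s)) ^ 2 = (1 - cos θ ^ 2) * (1 - s ^ 2) := by
    rw [mul_pow, sin_sq, sin_sq, cos_arccos hs hs']
  rcases le_total s (cos θ) with h | h
  · rw [abs_of_nonneg (by linarith)]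
    have : (1 - cos θ) * (1 + s) ≤ sin θ * sin (arccos s) := by
      refine (pow_le_pow_iff_left₀ (by nlinarith) hprod two_ne_zero).1 ?_
      rw [hsq]
      have : 0 ≤ (1 - cos θ) * (1 + s) := by nlinarith
      nlinarith
    linarith
  · rw [abs_of_nonpos (by linarith)]
    have : (1 + cos θ) * (1 - s) ≤ sin θ * sin (arccos s) := by
      refine (pow_le_pow_iff_left₀ (by nlinarith) hprod two_ne_zero).1 ?_
      rw [hsq]
      have : 0 ≤ (1 + cos θ) * (1 - s) := by nlinarith
      nlinarith
    linarith

theorem mul_sq_le_one_sub_cos {φ : ℝ} (h : |φ| ≤ 2 * π / 3) :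
    27 / (8 * π ^ 2) * φ ^ 2 ≤ 1 - cos φ := by
  have hchord : |φ| / 2 * (3 * √3 / (2 * π)) ≤ sin (|φ| / 2) := by
    have h0 := abs_nonneg φ
    have hle : |φ| * 3 / (2 * π) ≤ 1 := by
      rw [div_le_one (by positivity)]
      linarith
    have hc := strictConcaveOn_sin_Icc.concaveOn.2
      (show (0 : ℝ) ∈ Set.Icc 0 π from ⟨le_rfl, pi_pos.le⟩)
      (show π / 3 ∈ Set.Icc 0 π from ⟨by positivity, by linarith [pi_pos]⟩)
      (sub_nonneg.2 hle) (by positivity) (sub_add_cancel _ _)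
    simp only [smul_eq_mul, sin_zero, sin_pi_div_three, mul_zero, zero_add] at hc
    calc |φ| / 2 * (3 * √3 / (2 * π)) = |φ| * 3 / (2 * π) * (√3 / 2) := by ring
      _ ≤ sin (|φ| * 3 / (2 * π) * (π / 3)) := hc
      _ = sin (|φ| / 2) := by
          congr 1
          field_simp
  have hsq := pow_le_pow_left₀ (by positivity) hchord 2
  have hcos : cos φ = 1 - 2 * sin (|φ| / 2) ^ 2 := by
    rw [← cos_abs, show |φ| = 2 * (|φ| / 2) by ring, cos_two_mul, cos_sq']
    ring_nf
  have h3 : √3 ^ 2 = 3 := sq_sqrt (by norm_num)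
  have : 27 / (8 * π ^ 2) * φ ^ 2 = 2 * (|φ| / 2 * (3 * √3 / (2 * π))) ^ 2 := by
    simp only [mul_pow, div_pow, h3, sq_abs]
    ring
  linarith

theorem exp_neg_one_sub_cos_sq_le {c φ : ℝ} (hc : 0 ≤ c) (h : |φ| ≤ π) :
    rexp (-c * (1 - cos φ) ^ 2) ≤
      rexp (-(c * (27 / (8 * π ^ 2)) ^ 2) * |φ| ^ (4 : ℝ)) + rexp (-(9 / 4 * c)) := by
  rcases le_total |φ| (2 * π / 3) with hφ | hφ
  · refine le_add_of_le_of_nonneg (exp_le_exp.2 ?_) (exp_pos _).le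
    have h1 := pow_le_pow_left₀ (by positivity) (mul_sq_le_one_sub_cos hφ) 2
    have h2 : |φ| ^ (4 : ℝ) = (φ ^ 2) ^ 2 := by
      rw [← sq_abs φ, ← pow_mul]
      exact_mod_cast rpow_natCast |φ| 4
    rw [h2]
    nlinarith
  · refine le_add_of_nonneg_of_le (exp_pos _).le (exp_le_exp.2 ?_)
    have h1 : cos |φ| ≤ cos (2 * π / 3) := cos_le_cos_of_nonneg_of_le_pi (by positivity) h hφ
    have h2 : cos (2 * π / 3) = -(1 / 2) := by
      rw [show 2 * π / 3 = π - π / 3 by ring, cos_pi_sub, cos_pi_div_three]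
    rw [cos_abs, h2] at h1
    have h3 : (3 / 2 : ℝ) ^ 2 ≤ (1 - cos φ) ^ 2 := pow_le_pow_left₀ (by norm_num) (by linarith) 2
    nlinarith

theorem Gamma_le_one_of_mem_Icc {x : ℝ} (h1 : 1 ≤ x) (h2 : x ≤ 2) : Gamma x ≤ 1 := by
  have h := convexOn_Gamma.2 (show (1 : ℝ) ∈ Set.Ioi 0 by simp)
    (show (2 : ℝ) ∈ Set.Ioi 0 by simp) (sub_nonneg.2 h2) (sub_nonneg.2 h1) (by ring)
  simp only [smul_eq_mul, Gamma_one, Gamma_two] at h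
  rw [show (2 - x) * 1 + (x - 1) * 2 = x by ring] at h
  linarith

theorem integral_exp_neg_mul_abs_rpow_four_le {b : ℝ} (hb : 0 < b) (u v : ℝ) (huv : u ≤ v) :
    ∫ x in u..v, rexp (-b * |x| ^ (4 : ℝ)) ≤ 2 * b ^ (-(1 / 4) : ℝ) := by
  have hval := integral_comp_abs (f := fun x => rexp (-b * x ^ (4 : ℝ)))
  rw [integral_exp_neg_mul_rpow (by norm_num) hb] at hval
  have hΓ : 0 < Gamma (1 / 4 + 1) := Gamma_pos_of_pos (by norm_num)
  have hbpos : 0 < b ^ (-1 / 4 : ℝ) := rpow_pos_of_pos hb _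
  have hint : MeasureTheory.Integrable (fun x : ℝ => rexp (-b * |x| ^ (4 : ℝ))) := by
    by_contra hni
    rw [MeasureTheory.integral_undef hni] at hval
    have : 0 < 2 * (b ^ (-1 / 4 : ℝ) * Gamma (1 / 4 + 1)) := by positivity
    linarith
  rw [intervalIntegral.integral_of_le huv]
  refine (MeasureTheory.setIntegral_le_integral hint (.of_forall fun x => (exp_pos _).le)).trans ?_
  rw [hval, neg_div]
  have := Gamma_le_one_of_mem_Icc (x := 1 / 4 + 1) (by norm_num) (by norm_num)
  have hbpos' : 0 < b ^ (-(1 / 4) : ℝ) := rpow_pos_of_pos hb _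
  nlinarith

theorem integral_exp_neg_cos_sub_sq_le {R : ℝ} (hR : 0 < R) (a : ℝ) :
    ∫ θ in (0 : ℝ)..2 * π, rexp (-(R * cos θ - a) ^ 2) ≤
      2 * (2 * (R ^ 2 * (27 / (8 * π ^ 2)) ^ 2) ^ (-(1 / 4) : ℝ) +
        π * rexp (-(9 / 4 * R ^ 2))) := by
  have hcont : Continuous fun θ : ℝ => rexp (-(R * cos θ - a) ^ 2) := by fun_prop
  have hsymm : ∫ θ in π..2 * π, rexp (-(R * cos θ - a) ^ 2) =
      ∫ θ in (0 : ℝ)..π, rexp (-(R * cos θ - a) ^ 2) := by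
    have := intervalIntegral.integral_comp_sub_left (a := 0) (b := π)
      (fun θ => rexp (-(R * cos θ - a) ^ 2)) (2 * π)
    simp only [cos_two_pi_sub] at this
    rw [this]
    congr 1 <;> ring
  rw [← intervalIntegral.integral_add_adjacent_intervals (hcont.intervalIntegrable 0 π)
    (hcont.intervalIntegrable π (2 * π)), hsymm, ← two_mul]
  gcongr
  set α := arccos (a / R)
  have hα0 : 0 ≤ α := arccos_nonneg _
  have hαπ : α ≤ π := arccos_le_pi _
  set b := R ^ 2 * (27 / (8 * π ^ 2)) ^ 2
  have hg : Continuous fun φ : ℝ => rexp (-b * |φ| ^ (4 : ℝ)) := by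
    refine continuous_exp.comp (continuous_const.mul ?_)
    exact continuous_abs.rpow_const fun _ => Or.inr (by norm_num)
  have hg' : Continuous fun θ : ℝ => rexp (-b * |θ - α| ^ (4 : ℝ)) :=
    hg.comp (continuous_id.sub continuous_const)
  calc ∫ θ in (0 : ℝ)..π, rexp (-(R * cos θ - a) ^ 2)
      ≤ ∫ θ in (0 : ℝ)..π, (rexp (-b * |θ - α| ^ (4 : ℝ)) + rexp (-(9 / 4 * R ^ 2))) := by
        refine intervalIntegral.integral_mono_on pi_pos.le (hcont.intervalIntegrable _ _)
          ((hg'.add continuous_const).intervalIntegrable _ _) fun θ hθ => ?_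
        refine le_trans (exp_le_exp.2 ?_) (exp_neg_one_sub_cos_sq_le (sq_nonneg R)
          (φ := θ - α) (abs_le.2 ⟨by linarith [hθ.1], by linarith [hθ.2]⟩))
        have h1 := one_sub_cos_sub_arccos_le (a / R) hθ.1 hθ.2
        have h2 := pow_le_pow_left₀ (by linarith [cos_le_one (θ - α)]) h1 2
        rw [sq_abs] at h2
        have h3 : (R * cos θ - a) ^ 2 = R ^ 2 * (cos θ - a / R) ^ 2 := by
          field_simp
        rw [h3]
        nlinarith [sq_nonneg R]
    _ = (∫ φ in (0 - α)..(π - α), rexp (-b * |φ| ^ (4 : ℝ))) + π * rexp (-(9 / 4 * R ^ 2)) := by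
        rw [intervalIntegral.integral_add (hg'.intervalIntegrable _ _) (by simp),
          intervalIntegral.integral_comp_sub_right (fun φ => rexp (-b * |φ| ^ (4 : ℝ)))]
        simp
    _ ≤ _ := by
        gcongr
        exact integral_exp_neg_mul_abs_rpow_four_le (by positivity) _ _ (by linarith)

theorem factorial_mul_exp_div_pow_le {k : ℕ} (hk : 1 ≤ k) :
    (k.factorial : ℝ) * rexp k / (k : ℝ) ^ k ≤ rexp 1 * √k := by
  obtain ⟨m, rfl⟩ : ∃ m, k = m + 1 := ⟨k - 1, by lia⟩
  have h : Stirling.stirlingSeq (m + 1) ≤ Stirling.stirlingSeq 1 :=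
    Stirling.stirlingSeq'_antitone (Nat.zero_le m)
  rw [Stirling.stirlingSeq_one, Stirling.stirlingSeq, div_le_iff₀ (by positivity),
    Real.sqrt_mul (by norm_num), div_pow, ← Real.exp_nat_mul, mul_one] at h
  have h2 : (0 : ℝ) < √2 := by positivity
  rw [div_le_iff₀ (by positivity)]
  calc ((m + 1).factorial : ℝ) * rexp (m + 1 : ℕ)
      ≤ rexp 1 / √2 * (√2 * √(m + 1 : ℕ) * (((m + 1 : ℕ) : ℝ) ^ (m + 1) / rexp (m + 1 : ℕ))) *
        rexp (m + 1 : ℕ) := by gcongr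
    _ = _ := by field_simp

theorem integral_exp_neg_sqrt_mul_cos_sub_sq_le {k : ℕ} (hk : 1 ≤ k) (a : ℝ) :
    ∫ θ in (0 : ℝ)..2 * π, rexp (-(√k * cos θ - a) ^ 2) ≤ 2 * π * (1.2088 / √√k) := by
  have hk1 : (1 : ℝ) ≤ k := by exact_mod_cast hk
  refine (integral_exp_neg_cos_sub_sq_le (sqrt_pos.2 (by linarith)) a).trans ?_
  set t := √√(k : ℝ) with ht
  have ht2 : t ^ 2 = √k := sq_sqrt (sqrt_nonneg _)
  have ht4 : t ^ 4 = k := by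
    rw [show t ^ 4 = (t ^ 2) ^ 2 by ring, ht2, sq_sqrt (by linarith)]
  have ht1 : 1 ≤ t := one_le_sqrt.2 (one_le_sqrt.2 hk1)
  have htpos : 0 < t := by linarith
  rw [sq_sqrt (by linarith)]
  have hroot : (k * (27 / (8 * π ^ 2)) ^ 2 : ℝ) ^ (-(1 / 4) : ℝ) ≤ π / (1.837 * t) := by
    have hle : (1.837 * t / π) ^ 4 ≤ (k * (27 / (8 * π ^ 2)) ^ 2 : ℝ) := by
      rw [div_pow, mul_pow, ht4, div_pow, mul_pow, ← pow_mul, mul_div_assoc']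
      rw [div_le_div_iff₀ (by positivity) (by positivity)]
      have : 0 ≤ (k : ℝ) * π ^ 4 := by positivity
      norm_num
      nlinarith
    calc (k * (27 / (8 * π ^ 2)) ^ 2 : ℝ) ^ (-(1 / 4) : ℝ)
        ≤ ((1.837 * t / π) ^ 4) ^ (-(1 / 4) : ℝ) :=
          rpow_le_rpow_of_nonpos (by positivity) hle (by norm_num)
      _ = π / (1.837 * t) := by
          rw [← rpow_natCast, ← rpow_mul (by positivity)]
          norm_num [rpow_neg_one]
  have hexp : rexp (-(9 / 4 * k)) ≤ 0.12 / t := by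
    rw [le_div_iff₀ htpos]
    have htk : t ≤ rexp (k - 1) := by
      have h1 : t ≤ t ^ 4 := le_self_pow₀ ht1 (by norm_num)
      have h2 := add_one_le_exp ((k : ℝ) - 1)
      linarith
    have he : rexp (-(9 / 4)) ≤ 0.12 := by
      rw [Real.exp_neg]
      have h1 := exp_one_gt_d9
      have h2 := add_one_le_exp (1 / 4 : ℝ)
      have h3 : rexp (9 / 4) = rexp 1 * rexp 1 * rexp (1 / 4) := by
        rw [← Real.exp_add, ← Real.exp_add]
        norm_num
      have h4 : 7 ≤ rexp 1 * rexp 1 := by nlinarith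
      have h5 : 25 / 3 ≤ rexp (9 / 4) := by
        rw [h3]
        nlinarith
      calc (rexp (9 / 4))⁻¹ ≤ (25 / 3)⁻¹ := inv_anti₀ (by norm_num) h5
        _ = 0.12 := by norm_num
    calc rexp (-(9 / 4 * k)) * t ≤ rexp (-(9 / 4 * k)) * rexp (k - 1) := by gcongr
      _ = rexp (-(9 / 4 * k) + (k - 1)) := (Real.exp_add _ _).symm
      _ ≤ rexp (-(9 / 4)) := exp_le_exp.2 (by linarith)
      _ ≤ 0.12 := he
  calc 2 * (2 * (k * (27 / (8 * π ^ 2)) ^ 2 : ℝ) ^ (-(1 / 4) : ℝ) + π * rexp (-(9 / 4 * k)))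
      ≤ 2 * (2 * (π / (1.837 * t)) + π * (0.12 / t)) := by gcongr
    _ = 2 * π * ((2 / 1.837 + 0.12) / t) := by field_simp
    _ ≤ 2 * π * (1.2088 / t) := by
        gcongr
        norm_num

open Polynomial in
theorem abs_aeval_hermite_le {k : ℕ} (hk : 1 ≤ k) (y : ℝ) :
    |aeval y (hermite k)| ≤ 2 * √(k.factorial : ℝ) * rexp (y ^ 2 / 4) := by
  have hkpos : (0 : ℝ) < k := by exact_mod_cast hk
  have hR : 0 < √(k : ℝ) := sqrt_pos.2 hkpos
  have ht : 0 < √√(k : ℝ) := sqrt_pos.2 hR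
  have hcoef : (k.factorial : ℝ) * rexp (k / 2) / √k ^ k ≤
      1.6488 * √(k.factorial : ℝ) * √√k := by
    refine (pow_le_pow_iff_left₀ (by positivity) (by positivity) two_ne_zero).1 ?_
    have hS := factorial_mul_exp_div_pow_le hk
    have he : rexp (k / 2) ^ 2 = rexp k := by
      rw [← Real.exp_nat_mul]
      congr 1
      push_cast
      ring
    have hp : (√(k : ℝ) ^ k) ^ 2 = (k : ℝ) ^ k := by
      rw [← pow_mul, mul_comm, pow_mul, sq_sqrt hkpos.le]
    have he2 : rexp 1 ≤ 1.6488 ^ 2 := by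
      have := exp_one_lt_d9
      norm_num at this ⊢
      linarith
    rw [div_pow, mul_pow, mul_pow, mul_pow, he, hp, sq_sqrt (Nat.cast_nonneg _),
      sq_sqrt (sqrt_nonneg _)]
    calc (k.factorial : ℝ) ^ 2 * rexp k / (k : ℝ) ^ k
        = k.factorial * (k.factorial * rexp k / (k : ℝ) ^ k) := by ring
      _ ≤ k.factorial * (1.6488 ^ 2 * √k) := by gcongr; exact hS.trans (by gcongr)
      _ = _ := by ring
  calc |aeval y (hermite k)|
      ≤ k.factorial * rexp (y ^ 2 / 4 + √k ^ 2 / 2) / (2 * π * √k ^ k) *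
        (2 * π * (1.2088 / √√k)) :=
        (abs_aeval_hermite_le_integral k y hR).trans
          (by gcongr; exact integral_exp_neg_sqrt_mul_cos_sub_sq_le hk _)
    _ = k.factorial * rexp (k / 2) / √k ^ k * (1.2088 / √√k * rexp (y ^ 2 / 4)) := by
        rw [Real.exp_add, sq_sqrt hkpos.le]
        field_simp
    _ ≤ 1.6488 * √(k.factorial : ℝ) * √√k * (1.2088 / √√k * rexp (y ^ 2 / 4)) := by gcongr
    _ = 1.6488 * 1.2088 * √(k.factorial : ℝ) * rexp (y ^ 2 / 4) := by field_simp
    _ ≤ 2 * √(k.factorial : ℝ) * rexp (y ^ 2 / 4) := by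
        gcongr
        norm_num

/-- For every `k ≥ 1` and `y ∈ ℝ`,
`|φ(y) H_k(y)| ≤ √(2/π) √(k!) e^{−y²/4} ≤ √(2/π) √(k!)`. -/
theorem gaussian_hermite_upper_bound (k : ℕ) (hk : 1 ≤ k) (y : ℝ) :
    |stdGaussianPDF y * hermiteP k y| ≤
        Real.sqrt (2 / π) * Real.sqrt (k.factorial : ℝ) * Real.exp (-y ^ 2 / 4) ∧
      Real.sqrt (2 / π) * Real.sqrt (k.factorial : ℝ) * Real.exp (-y ^ 2 / 4) ≤
        Real.sqrt (2 / π) * Real.sqrt (k.factorial : ℝ) := by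
  refine ⟨?_, mul_le_of_le_one_right (by positivity)
    (exp_le_one_iff.2 (by linarith [sq_nonneg y]))⟩
  have hconst : √(2 / π) = 1 / √(2 * π) * 2 := by
    rw [show 2 / π = 2 ^ 2 / (2 * π) by field_simp, sqrt_div (by norm_num),
      sqrt_sq (by norm_num)]
    ring
  have hexp : rexp (-y ^ 2 / 2) * rexp (y ^ 2 / 4) = rexp (-y ^ 2 / 4) := by
    rw [← Real.exp_add]
    ring_nf
  rw [abs_mul, hermiteP_eq_aeval, stdGaussianPDF, abs_of_pos (by positivity), hconst, ← hexp]
  calc 1 / √(2 * π) * rexp (-y ^ 2 / 2) * |Polynomial.aeval y (Polynomial.hermite k)|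
      ≤ 1 / √(2 * π) * rexp (-y ^ 2 / 2) * (2 * √(k.factorial : ℝ) * rexp (y ^ 2 / 4)) := by
        gcongr
        exact abs_aeval_hermite_le hk y
    _ = _ := by ring
end

section
/- Let φ(x) = (1/√(2π)) e^{−x²/2}, Φ(x) = ∫_{−∞}^x φ(y) dy, and let H_k denote the k-th probabilist's Hermite polynomial. For every ρ ∈ (0,1) and all b, x ∈ ℝ, the series Σ_{k=1}^∞ (ρ^k/k!) H_{k−1}(b) H_k(x) converges and Φ((b − ρx)/√(1 − ρ²)) = Φ(b) − φ(b) · Σ_{k=1}^∞ (ρ^k/k!) H_{k−1}(b) H_k(x). -/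
open Real Finset

/-- The standard Gaussian cumulative distribution function `Φ(x) = ∫_{−∞}^x φ(y) dy`. -/
noncomputable def stdGaussianCDF (x : ℝ) : ℝ := ∫ y in Set.Iic x, stdGaussianPDF y

open Filter Topology Asymptotics

/-! ### The three-term recurrence -/

/-- The `j`-th summand of `hermiteP k x`, extended by zero to all `j`. -/
noncomputable def hermiteTerm (k j : ℕ) (x : ℝ) : ℝ :=
  if 2 * j ≤ k then
    ((k.factorial : ℝ) * (-1 : ℝ) ^ j /
        (2 ^ j * (j.factorial : ℝ) * ((k - 2 * j).factorial : ℝ))) * x ^ (k - 2 * j)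
  else 0

lemma hermiteP_eq_sum_hermiteTerm {k N : ℕ} (h : k < N) (x : ℝ) :
    hermiteP k x = ∑ j ∈ range N, hermiteTerm k j x := by
  have hsub : range (k / 2 + 1) ⊆ range N := by
    intro j hj
    simp only [mem_range] at hj ⊢
    omega
  rw [← Finset.sum_subset hsub]
  · refine Finset.sum_congr rfl fun j hj => ?_
    rw [mem_range] at hj
    rw [hermiteTerm, if_pos (by omega)]
  · intro j _ hj
    rw [mem_range] at hj
    rw [hermiteTerm, if_neg (by omega)]

lemma hermiteTerm_zero (k : ℕ) (x : ℝ) : hermiteTerm k 0 x = x ^ k := by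
  have : (k.factorial : ℝ) ≠ 0 := by positivity
  simp [hermiteTerm, this]

lemma hermiteTerm_succ (k j : ℕ) (x : ℝ) :
    hermiteTerm (k + 2) (j + 1) x
      = x * hermiteTerm (k + 1) (j + 1) x - (k + 1) * hermiteTerm k j x := by
  rcases lt_or_ge k (2 * j) with h | h
  · simp [hermiteTerm, show ¬ 2 * (j + 1) ≤ k + 2 by omega,
      show ¬ 2 * (j + 1) ≤ k + 1 by omega, show ¬ 2 * j ≤ k by omega]
  obtain ⟨m, rfl⟩ := Nat.exists_eq_add_of_le h
  have e₁ : 2 * j + m + 2 - 2 * (j + 1) = m := by omega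
  have e₂ : 2 * j + m - 2 * j = m := by omega
  rw [hermiteTerm, hermiteTerm, hermiteTerm, if_pos (by omega),
    if_pos (show 2 * j ≤ 2 * j + m by omega), e₁, e₂]
  rcases m with _ | m
  · rw [if_neg (by omega)]
    simp only [Nat.factorial_succ, add_zero, Nat.factorial_zero]
    push_cast
    field_simp
    ring
  · have e₃ : 2 * j + (m + 1) + 1 - 2 * (j + 1) = m := by omega
    rw [if_pos (by omega), e₃]
    simp only [Nat.factorial_succ, ← add_assoc]
    push_cast
    field_simp
    ring

lemma hermiteP_zero (x : ℝ) : hermiteP 0 x = 1 := by simp [hermiteP]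

lemma hermiteP_one (x : ℝ) : hermiteP 1 x = x := by simp [hermiteP]

lemma hermiteP_add_two (k : ℕ) (x : ℝ) :
    hermiteP (k + 2) x = x * hermiteP (k + 1) x - (k + 1) * hermiteP k x := by
  rw [hermiteP_eq_sum_hermiteTerm (show k + 2 < k + 2 + 1 by omega),
    hermiteP_eq_sum_hermiteTerm (show k + 1 < k + 2 + 1 by omega),
    hermiteP_eq_sum_hermiteTerm (show k < k + 2 by omega), Finset.sum_range_succ',
    Finset.sum_range_succ' (fun j => hermiteTerm (k + 1) j x), mul_add, Finset.mul_sum,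
    Finset.mul_sum]
  simp only [hermiteTerm_succ, hermiteTerm_zero, Finset.sum_sub_distrib]
  ring

/-! ### Growth of the Hermite polynomials -/

lemma abs_hermiteP_le (x : ℝ) {r : ℝ} (hr : 1 < r) :
    ∃ C : ℝ, 0 ≤ C ∧ ∀ k, |hermiteP k x| ≤ C * (r ^ k * √(k.factorial : ℝ)) := by
  obtain ⟨N, hN⟩ : ∃ N : ℕ, ∀ k ≥ N, |x| * r ≤ (r ^ 2 - 1) * √((k : ℝ) + 1) := by
    have h : Tendsto (fun k : ℕ => (r ^ 2 - 1) * √((k : ℝ) + 1)) atTop atTop := by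
      refine Tendsto.const_mul_atTop (by nlinarith) ?_
      exact Real.tendsto_sqrt_atTop.comp
        (tendsto_atTop_add_const_right _ _ tendsto_natCast_atTop_atTop)
    exact eventually_atTop.1 (h.eventually_ge_atTop _)
  have hC : 0 ≤ ∑ i ∈ range (N + 2), |hermiteP i x| := Finset.sum_nonneg fun _ _ => abs_nonneg _
  refine ⟨∑ i ∈ range (N + 2), |hermiteP i x|, hC, fun k => ?_⟩
  set C := ∑ i ∈ range (N + 2), |hermiteP i x|
  have small : ∀ k < N + 2, |hermiteP k x| ≤ C * (r ^ k * √(k.factorial : ℝ)) := by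
    intro k hk
    have h₁ : |hermiteP k x| ≤ C :=
      Finset.single_le_sum (f := fun i => |hermiteP i x|) (fun _ _ => abs_nonneg _)
        (mem_range.2 hk)
    have h₂ : 1 ≤ √(k.factorial : ℝ) := by
      rw [Real.one_le_sqrt]
      exact_mod_cast Nat.one_le_iff_ne_zero.2 k.factorial_ne_zero
    exact h₁.trans (le_mul_of_one_le_right hC (one_le_mul_of_one_le_of_one_le
      (one_le_pow₀ hr.le) h₂))
  induction k using Nat.strong_induction_on with
  | _ k ih =>
    rcases lt_or_ge k (N + 2) with hk | hk
    · exact small k hk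
    obtain ⟨k, rfl⟩ : ∃ m, k = m + 2 := ⟨k - 2, by omega⟩
    have i₁ := ih (k + 1) (by omega)
    have i₀ := ih k (by omega)
    have hx := hN k (by omega)
    set s := √((k : ℝ) + 1) with hs
    have hs0 : 0 ≤ s := Real.sqrt_nonneg _
    have hss : s * s = k + 1 := Real.mul_self_sqrt (by positivity)
    have hst : s ≤ √((k : ℝ) + 2) := Real.sqrt_le_sqrt (by linarith)
    have f₁ : √((k + 1).factorial : ℝ) = s * √(k.factorial : ℝ) := by
      rw [Nat.factorial_succ, Nat.cast_mul, Real.sqrt_mul (by positivity)]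
      push_cast
      rfl
    have f₂ : √((k + 2).factorial : ℝ) = √((k : ℝ) + 2) * (s * √(k.factorial : ℝ)) := by
      rw [Nat.factorial_succ, Nat.cast_mul, Real.sqrt_mul (by positivity), f₁]
      push_cast
      congr 2
      ring
    rw [f₁] at i₁
    rw [f₂, hermiteP_add_two]
    have hr0 : 0 < r := by linarith
    calc |x * hermiteP (k + 1) x - (k + 1) * hermiteP k x|
        ≤ |x| * |hermiteP (k + 1) x| + (k + 1) * |hermiteP k x| := by
          refine (abs_sub _ _).trans (le_of_eq ?_)
          rw [abs_mul, abs_mul, abs_of_nonneg (show (0 : ℝ) ≤ k + 1 by positivity)]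
      _ ≤ |x| * (C * (r ^ (k + 1) * (s * √(k.factorial : ℝ))))
            + (k + 1) * (C * (r ^ k * √(k.factorial : ℝ))) := by gcongr
      _ = C * r ^ k * √(k.factorial : ℝ) * s * (|x| * r + s) := by
          rw [← hss]; ring
      _ ≤ C * r ^ k * √(k.factorial : ℝ) * s * (r ^ 2 * √((k : ℝ) + 2)) := by
          gcongr
          nlinarith [mul_le_mul_of_nonneg_left hst (sq_nonneg r)]
      _ = C * (r ^ (k + 2) * (√((k : ℝ) + 2) * (s * √(k.factorial : ℝ)))) := by ring

lemma isBigO_hermiteP_add (x : ℝ) (j : ℕ) {r : ℝ} (hr : 1 < r) :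
    (fun k => hermiteP (k + j) x) =O[atTop] fun k => r ^ k * √(k.factorial : ℝ) := by
  induction j generalizing r with
  | zero =>
    obtain ⟨C, -, hC⟩ := abs_hermiteP_le x hr
    refine IsBigO.of_bound C (Eventually.of_forall fun k => ?_)
    rw [Real.norm_eq_abs, Real.norm_of_nonneg (by positivity)]
    exact hC k
  | succ j ih =>
    set s := √r with hs
    have hs1 : 1 < s := by rwa [hs, Real.lt_sqrt zero_le_one, one_pow]
    have hss : s * s = r := Real.mul_self_sqrt (by linarith)
    have h₁ := (ih hs1).comp_tendsto (tendsto_add_atTop_nat 1)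
    have h₂ : (fun k : ℕ => √((k : ℝ) + 1)) =O[atTop] fun k => s ^ k := by
      have h₃ : (fun k : ℕ => √((k : ℝ) + 1)) =O[atTop] fun k : ℕ => (k : ℝ) ^ 1 := by
        refine IsBigO.of_bound 2 ((eventually_ge_atTop 1).mono fun k hk => ?_)
        have hk' : (1 : ℝ) ≤ k := by exact_mod_cast hk
        rw [Real.norm_of_nonneg (Real.sqrt_nonneg _), Real.norm_of_nonneg (by positivity),
          Real.sqrt_le_iff]
        constructor <;> nlinarith
      exact h₃.trans (isLittleO_pow_const_const_pow_of_one_lt 1 hs1).isBigO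
    have h₄ : (fun k : ℕ => s ^ (k + 1) * √((k + 1).factorial : ℝ)) =O[atTop]
        fun k => r ^ k * √(k.factorial : ℝ) := by
      have h₅ := (h₂.mul
        (isBigO_refl (fun k : ℕ => s ^ k * √(k.factorial : ℝ)) atTop)).const_mul_left s
      refine h₅.congr (fun k => ?_) fun k => ?_
      · rw [Nat.factorial_succ, Nat.cast_mul, Real.sqrt_mul (by positivity)]
        push_cast
        ring
      · rw [← hss, mul_pow]
        ring
    refine (h₁.trans h₄).congr_left fun k => ?_
    simp only [Function.comp_apply]
    congr 1
    omega

/-! ### Mehler-type series -/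

/-- The coefficient of `t ^ k` in the Mehler-type series with index shifts `i` and `j`. -/
noncomputable def mehlerCoeff (b x : ℝ) (i j k : ℕ) : ℝ :=
  hermiteP (k + i) b * hermiteP (k + j) x / (k.factorial : ℝ)

lemma summable_mehlerCoeff (b x : ℝ) (i j : ℕ) {t : ℝ} (ht : |t| < 1) :
    Summable fun k => mehlerCoeff b x i j k * t ^ k := by
  obtain ⟨r, hr1, hrt⟩ : ∃ r : ℝ, 1 < r ∧ r * r * |t| < 1 := by
    have hc : Tendsto (fun r : ℝ => r * r * |t|) (𝓝[>] 1) (𝓝 (1 * 1 * |t|)) :=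
      (Continuous.tendsto (by fun_prop) 1).mono_left nhdsWithin_le_nhds
    have h := (hc.eventually_lt_const (by simpa using ht)).and self_mem_nhdsWithin
    obtain ⟨r, h₁, h₂⟩ := h.exists
    exact ⟨r, h₂, h₁⟩
  have h := (((isBigO_hermiteP_add b i hr1).mul (isBigO_hermiteP_add x j hr1)).mul
    (isBigO_refl (fun k : ℕ => ((k.factorial : ℝ))⁻¹ * t ^ k) atTop))
  refine summable_of_isBigO_nat (g := fun k => (r * r * |t|) ^ k)
    (summable_geometric_of_lt_one (by positivity) hrt) ?_
  refine IsBigO.trans (h.congr_left fun k => ?_)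
    (IsBigO.of_bound 1 (Eventually.of_forall fun k => ?_))
  · rw [mehlerCoeff]
    ring
  · have hk : √(k.factorial : ℝ) * √(k.factorial : ℝ) = k.factorial :=
      Real.mul_self_sqrt (by positivity)
    have hk0 : (k.factorial : ℝ) ≠ 0 := by positivity
    have e : r ^ k * √(k.factorial : ℝ) * (r ^ k * √(k.factorial : ℝ))
        * (((k.factorial : ℝ))⁻¹ * t ^ k) = (r * r * t) ^ k := by
      calc _ = r ^ k * r ^ k * (√(k.factorial : ℝ) * √(k.factorial : ℝ))
            * (((k.factorial : ℝ))⁻¹ * t ^ k) := by ring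
        _ = _ := by rw [hk, mul_pow, mul_pow]; field_simp
    rw [e, one_mul, norm_pow, norm_pow]
    simp

/-- The sum `∑ t ^ k / k! * H_{k+i}(b) * H_{k+j}(x)`. -/
noncomputable def mehlerSeries (b x : ℝ) (i j : ℕ) (t : ℝ) : ℝ :=
  ∑' k, mehlerCoeff b x i j k * t ^ k

lemma hasSum_mehlerSeries (b x : ℝ) (i j : ℕ) {t : ℝ} (ht : |t| < 1) :
    HasSum (fun k => mehlerCoeff b x i j k * t ^ k) (mehlerSeries b x i j t) :=
  (summable_mehlerCoeff b x i j ht).hasSum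

lemma mehlerSeries_comm (b x : ℝ) (i j : ℕ) (t : ℝ) :
    mehlerSeries b x i j t = mehlerSeries x b j i t := by
  simp only [mehlerSeries, mehlerCoeff, mul_comm (hermiteP (_ + i) b)]

lemma HasSum.of_succ {f g : ℕ → ℝ} {a : ℝ} (h : HasSum g a) (h₀ : f 0 = 0)
    (hs : ∀ k, f (k + 1) = g k) : HasSum f a := by
  rw [← hasSum_nat_add_iff' 1]
  simpa [h₀, hs] using h

/-- The recurrence for a single shift in the first variable. -/
lemma mehlerSeries_one_left (b x : ℝ) (j : ℕ) {t : ℝ} (ht : |t| < 1) :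
    mehlerSeries b x 1 j t = b * mehlerSeries b x 0 j t - t * mehlerSeries b x 0 (j + 1) t := by
  have h₁ := hasSum_mehlerSeries b x 1 j ht
  have h₀ := (hasSum_mehlerSeries b x 0 j ht).mul_left b
  have h₂ := (hasSum_mehlerSeries b x 0 (j + 1) ht).mul_left t
  have h₃ := h₀.sub h₁
  have h₄ : HasSum (fun k => b * (mehlerCoeff b x 0 j k * t ^ k) - mehlerCoeff b x 1 j k * t ^ k)
      (t * mehlerSeries b x 0 (j + 1) t) := by
    refine h₂.of_succ ?_ fun k => ?_
    · simp [mehlerCoeff, hermiteP_zero, hermiteP_one]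
    · have hk0 : (k.factorial : ℝ) ≠ 0 := by positivity
      simp only [mehlerCoeff, add_zero, hermiteP_add_two k b, Nat.factorial_succ,
        show k + 1 + j = k + (j + 1) by omega, show k + 1 + 1 = k + 2 by omega]
      push_cast
      field_simp
      ring
  linarith [h₃.unique h₄]

/-- The recurrence for a double shift in the second variable. -/
lemma mehlerSeries_zero_two (b x : ℝ) {t : ℝ} (ht : |t| < 1) :
    mehlerSeries b x 0 2 t
      = x * mehlerSeries b x 0 1 t - mehlerSeries b x 0 0 t - t * mehlerSeries b x 1 1 t := by
  have h₂ := hasSum_mehlerSeries b x 0 2 ht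
  have h₁ := (hasSum_mehlerSeries b x 0 1 ht).mul_left x
  have h₀ := hasSum_mehlerSeries b x 0 0 ht
  have hd := (hasSum_mehlerSeries b x 1 1 ht).mul_left t
  have h₃ := (h₁.sub h₀).sub h₂
  have h₄ : HasSum (fun k => x * (mehlerCoeff b x 0 1 k * t ^ k) - mehlerCoeff b x 0 0 k * t ^ k
      - mehlerCoeff b x 0 2 k * t ^ k) (t * mehlerSeries b x 1 1 t) := by
    refine hd.of_succ ?_ fun k => ?_
    · have := hermiteP_add_two 0 x
      simp only [zero_add, CharP.cast_eq_zero, one_mul] at this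
      simp [mehlerCoeff, this, hermiteP_zero, hermiteP_one]
    · have hk0 : (k.factorial : ℝ) ≠ 0 := by positivity
      simp only [mehlerCoeff, add_zero, hermiteP_add_two (k + 1) x, Nat.factorial_succ]
      push_cast
      field_simp
      ring
  linarith [h₃.unique h₄]

lemma mehlerSeries_zero_one (b x : ℝ) {t : ℝ} (ht : |t| < 1) :
    (1 - t ^ 2) * mehlerSeries b x 0 1 t = (x - t * b) * mehlerSeries b x 0 0 t := by
  have h₁ := mehlerSeries_one_left b x 0 ht
  have h₂ := mehlerSeries_one_left x b 0 ht
  rw [mehlerSeries_comm x b 1 0, mehlerSeries_comm x b 0 0, mehlerSeries_comm x b 0 (0 + 1)] at h₂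
  simp only [zero_add] at h₁ h₂
  rw [h₁] at h₂
  linarith

lemma mehlerSeries_one_one (b x : ℝ) {t : ℝ} (ht : |t| < 1) :
    (1 - t ^ 2) * mehlerSeries b x 1 1 t
      = (b - t * x) * mehlerSeries b x 0 1 t + t * mehlerSeries b x 0 0 t := by
  have h₁ := mehlerSeries_one_left b x 1 ht
  have h₂ := mehlerSeries_zero_two b x ht
  simp only [Nat.reduceAdd] at h₁
  rw [h₂] at h₁
  linarith

/-- A power series convergent on the unit interval may be integrated termwise. -/
lemma hasDerivAt_tsum_div_succ {c : ℕ → ℝ}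
    (hc : ∀ t : ℝ, |t| < 1 → Summable fun k => c k * t ^ k) {t : ℝ} (ht : |t| < 1) :
    Summable (fun k : ℕ => c k / (k + 1) * t ^ (k + 1)) ∧
    HasDerivAt (fun s => ∑' k : ℕ, c k / (k + 1) * s ^ (k + 1)) (∑' k, c k * t ^ k) t := by
  obtain ⟨R, htR, hR⟩ := exists_between ht
  have hR0 : 0 ≤ R := (abs_nonneg t).trans htR.le
  have hu : Summable fun k => ‖c k * R ^ k‖ := (hc R (by rwa [abs_of_nonneg hR0])).norm
  have hd : ∀ (k : ℕ) (y : ℝ), y ∈ Metric.ball (0 : ℝ) R →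
      HasDerivAt (fun s => c k / (k + 1) * s ^ (k + 1)) (c k * y ^ k) y := by
    intro k y _
    have h := (hasDerivAt_pow (k + 1) y).const_mul (c k / (k + 1))
    refine h.congr_deriv ?_
    push_cast
    field_simp
  have hb : ∀ (k : ℕ) (y : ℝ), y ∈ Metric.ball (0 : ℝ) R → ‖c k * y ^ k‖ ≤ ‖c k * R ^ k‖ := by
    intro k y hy
    rw [mem_ball_zero_iff] at hy
    rw [norm_mul, norm_mul, norm_pow, norm_pow, Real.norm_of_nonneg hR0]
    gcongr
  have h0 : (0 : ℝ) ∈ Metric.ball (0 : ℝ) R := by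
    rw [mem_ball_zero_iff, norm_zero]
    exact (abs_nonneg t).trans_lt htR
  have hs0 : Summable fun k : ℕ => c k / (k + 1) * (0 : ℝ) ^ (k + 1) := by simp [summable_zero]
  have htm : t ∈ Metric.ball (0 : ℝ) R := by rwa [mem_ball_zero_iff]
  have hpc : IsPreconnected (Metric.ball (0 : ℝ) R) := (convex_ball _ _).isPreconnected
  exact ⟨summable_of_summable_hasDerivAt_of_isPreconnected
      (g := fun (k : ℕ) (s : ℝ) => c k / (k + 1) * s ^ (k + 1)) (g' := fun k s => c k * s ^ k)
      hu Metric.isOpen_ball hpc hd hb h0 hs0 htm,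
    hasDerivAt_tsum_of_isPreconnected
      (g := fun (k : ℕ) (s : ℝ) => c k / (k + 1) * s ^ (k + 1)) (g' := fun k s => c k * s ^ k)
      hu Metric.isOpen_ball hpc hd hb h0 hs0 htm⟩

lemma hasDerivAt_mehlerSeries_zero_zero (b x : ℝ) {t : ℝ} (ht : |t| < 1) :
    HasDerivAt (mehlerSeries b x 0 0) (mehlerSeries b x 1 1 t) t := by
  have h := (hasDerivAt_tsum_div_succ (fun s hs => summable_mehlerCoeff b x 1 1 hs) ht).2
  have hopen : {s : ℝ | |s| < 1} ∈ 𝓝 t := (isOpen_lt continuous_abs continuous_const).mem_nhds ht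
  refine (h.const_add (1 : ℝ)).congr_of_eventuallyEq ?_
  filter_upwards [hopen] with s hs
  rw [mehlerSeries, (summable_mehlerCoeff b x 0 0 hs).tsum_eq_zero_add]
  congr 1
  · simp [mehlerCoeff, hermiteP_zero]
  · refine tsum_congr fun k => ?_
    have hk0 : (k.factorial : ℝ) ≠ 0 := by positivity
    simp only [mehlerCoeff, add_zero, Nat.factorial_succ]
    push_cast
    field_simp

lemma mehlerSeries_zero_zero_at_zero (b x : ℝ) : mehlerSeries b x 0 0 0 = 1 := by
  rw [mehlerSeries, tsum_eq_single 0 (fun k hk => by simp [hk])]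
  simp [mehlerCoeff, hermiteP_zero]

lemma eq_of_hasDerivAt_zero_of_abs_lt_one {f : ℝ → ℝ} (hf : ∀ t, |t| < 1 → HasDerivAt f 0 t)
    {t : ℝ} (ht : |t| < 1) : f t = f 0 := by
  have hmem : ∀ s : ℝ, s ∈ Metric.ball (0 : ℝ) 1 ↔ |s| < 1 := fun s => by
    rw [mem_ball_zero_iff, Real.norm_eq_abs]
  refine Metric.isOpen_ball.is_const_of_deriv_eq_zero (convex_ball (0 : ℝ) 1).isPreconnected
    (fun s hs => ((hf s ((hmem s).1 hs)).differentiableAt).differentiableWithinAt)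
    (fun s hs => (hf s ((hmem s).1 hs)).deriv) ((hmem t).2 ht) ((hmem 0).2 (by simp))

lemma one_sub_sq_pos_of_abs_lt_one {t : ℝ} (ht : |t| < 1) : 0 < 1 - t ^ 2 := by
  have := (sq_lt_one_iff_abs_lt_one t).2 ht
  linarith

lemma hasDerivAt_sqrt_one_sub_sq {t : ℝ} (ht : |t| < 1) :
    HasDerivAt (fun s : ℝ => √(1 - s ^ 2)) (-t / √(1 - t ^ 2)) t := by
  have hp := one_sub_sq_pos_of_abs_lt_one ht
  have h := (((hasDerivAt_pow 2 t).const_sub 1).sqrt hp.ne')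
  refine h.congr_deriv ?_
  have := (Real.sqrt_pos.2 hp).ne'
  field_simp
  norm_num

/-- Mehler's formula. -/
lemma mehlerSeries_zero_zero_mul (b x : ℝ) {t : ℝ} (ht : |t| < 1) :
    mehlerSeries b x 0 0 t * (√(1 - t ^ 2)
      * Real.exp ((b - t * x) ^ 2 / (1 - t ^ 2) / 2)) = Real.exp (b ^ 2 / 2) := by
  have key := eq_of_hasDerivAt_zero_of_abs_lt_one
    (f := fun t => mehlerSeries b x 0 0 t * (√(1 - t ^ 2)
      * Real.exp ((b - t * x) ^ 2 / (1 - t ^ 2) / 2))) (fun t ht => ?_) ht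
  · simpa [mehlerSeries_zero_zero_at_zero] using key
  have hp := one_sub_sq_pos_of_abs_lt_one ht
  have hsq : √(1 - t ^ 2) ^ 2 = 1 - t ^ 2 := Real.sq_sqrt hp.le
  have hs := (Real.sqrt_pos.2 hp).ne'
  have hv : HasDerivAt (fun t : ℝ => (b - t * x) ^ 2 / (1 - t ^ 2) / 2)
      (-(b - t * x) * (x - t * b) / (1 - t ^ 2) ^ 2) t := by
    have h₁ : HasDerivAt (fun t : ℝ => (b - t * x) ^ 2) (2 * (b - t * x) * (-x)) t := by
      refine ((((hasDerivAt_id t).mul_const x).const_sub b).pow 2).congr_deriv ?_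
      simp
    have h₂ : HasDerivAt (fun t : ℝ => 1 - t ^ 2) (-(2 * t)) t := by
      simpa using (hasDerivAt_pow 2 t).const_sub 1
    refine ((h₁.div h₂ hp.ne').div_const 2).congr_deriv ?_
    field_simp
    ring
  have h := (hasDerivAt_mehlerSeries_zero_zero b x ht).mul
    ((hasDerivAt_sqrt_one_sub_sq ht).mul hv.exp)
  have hC : mehlerSeries b x 0 1 t = (x - t * b) * mehlerSeries b x 0 0 t / (1 - t ^ 2) := by
    rw [eq_div_iff hp.ne', mul_comm, mehlerSeries_zero_one b x ht]
  have hD : mehlerSeries b x 1 1 t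
      = ((b - t * x) * mehlerSeries b x 0 1 t + t * mehlerSeries b x 0 0 t) / (1 - t ^ 2) := by
    rw [eq_div_iff hp.ne', mul_comm, mehlerSeries_one_one b x ht]
  refine h.congr_deriv ?_
  simp only [Pi.mul_apply]
  rw [hD, hC]
  set E := Real.exp ((b - t * x) ^ 2 / (1 - t ^ 2) / 2)
  set A := mehlerSeries b x 0 0 t
  set s := √(1 - t ^ 2)
  rw [← hsq]
  field_simp
  rw [hsq]
  ring

/-! ### The Gaussian distribution function -/

lemma continuous_stdGaussianPDF : Continuous stdGaussianPDF := by
  unfold stdGaussianPDF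
  fun_prop

lemma integrable_stdGaussianPDF : MeasureTheory.Integrable stdGaussianPDF := by
  have h := (integrable_exp_neg_mul_sq (show (0 : ℝ) < 1 / 2 by norm_num)).const_mul
    (1 / √(2 * π))
  refine h.congr (Eventually.of_forall fun y => ?_)
  simp only [stdGaussianPDF]
  congr 2
  ring

lemma hasDerivAt_stdGaussianCDF (u : ℝ) : HasDerivAt stdGaussianCDF (stdGaussianPDF u) u := by
  have h : HasDerivAt (fun v => stdGaussianCDF 0 + ∫ y in (0 : ℝ)..v, stdGaussianPDF y)
      (stdGaussianPDF u) u :=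
    (continuous_stdGaussianPDF.integral_hasStrictDerivAt 0 u).hasDerivAt.const_add _
  refine h.congr_of_eventuallyEq (Eventually.of_forall fun v => ?_)
  simp only [stdGaussianCDF]
  rw [← intervalIntegral.integral_Iic_sub_Iic integrable_stdGaussianPDF.integrableOn
    integrable_stdGaussianPDF.integrableOn]
  ring

lemma hasDerivAt_stdGaussianCDF_comp (b x : ℝ) {t : ℝ} (ht : |t| < 1) :
    HasDerivAt (fun s => stdGaussianCDF ((b - s * x) / √(1 - s ^ 2)))
      (-(stdGaussianPDF b * mehlerSeries b x 0 1 t)) t := by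
  have hp := one_sub_sq_pos_of_abs_lt_one ht
  have hsq : √(1 - t ^ 2) ^ 2 = 1 - t ^ 2 := Real.sq_sqrt hp.le
  have hs := (Real.sqrt_pos.2 hp).ne'
  have h₁ : HasDerivAt (fun s : ℝ => b - s * x) (-x) t := by
    simpa using ((hasDerivAt_id t).mul_const x).const_sub b
  have h := (hasDerivAt_stdGaussianCDF ((b - t * x) / √(1 - t ^ 2))).comp t
    (h₁.div (hasDerivAt_sqrt_one_sub_sq ht) hs)
  refine h.congr_deriv ?_
  have hC : mehlerSeries b x 0 1 t = (x - t * b) * mehlerSeries b x 0 0 t / (1 - t ^ 2) := by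
    rw [eq_div_iff hp.ne', mul_comm, mehlerSeries_zero_one b x ht]
  have hM := mehlerSeries_zero_zero_mul b x ht
  have hA : Real.exp (-b ^ 2 / 2) * mehlerSeries b x 0 0 t
      = Real.exp (-((b - t * x) / √(1 - t ^ 2)) ^ 2 / 2) / √(1 - t ^ 2) := by
    rw [div_pow, hsq, neg_div, neg_div, Real.exp_neg, Real.exp_neg, ← hM]
    have hA0 : mehlerSeries b x 0 0 t ≠ 0 := by
      intro h0
      rw [h0, zero_mul] at hM
      exact (Real.exp_pos _).ne hM
    field_simp
  simp only [stdGaussianPDF]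
  rw [hC, show 1 / √(2 * π) * Real.exp (-b ^ 2 / 2)
        * ((x - t * b) * mehlerSeries b x 0 0 t / (1 - t ^ 2))
      = 1 / √(2 * π) * (x - t * b) / (1 - t ^ 2)
        * (Real.exp (-b ^ 2 / 2) * mehlerSeries b x 0 0 t) by ring, hA]
  set E := Real.exp (-((b - t * x) / √(1 - t ^ 2)) ^ 2 / 2)
  set s := √(1 - t ^ 2)
  rw [← hsq]
  field_simp
  rw [hsq]
  ring

/-- Mehler expansion of the Gaussian CDF: for `ρ ∈ (0,1)` and `b, x ∈ ℝ`, the series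
`Σ_{k=1}^∞ (ρ^k/k!) H_{k−1}(b) H_k(x)` converges, with sum `S` satisfying
`Φ((b − ρx)/√(1 − ρ²)) = Φ(b) − φ(b) S`. -/
theorem gaussianCDF_mehler_expansion (ρ : ℝ) (hρ : ρ ∈ Set.Ioo (0 : ℝ) 1) (b x : ℝ) :
    ∃ S : ℝ,
      HasSum (fun k : ℕ =>
        ρ ^ (k + 1) / ((k + 1).factorial : ℝ) * hermiteP k b * hermiteP (k + 1) x) S ∧
      stdGaussianCDF ((b - ρ * x) / Real.sqrt (1 - ρ ^ 2)) =
        stdGaussianCDF b - stdGaussianPDF b * S := by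
  have hρ' : |ρ| < 1 := by
    rw [abs_of_pos hρ.1]
    exact hρ.2
  have hG : ∀ {t : ℝ}, |t| < 1 → _ := fun {t} ht =>
    hasDerivAt_tsum_div_succ (fun s hs => summable_mehlerCoeff b x 0 1 hs) ht
  refine ⟨∑' k : ℕ, mehlerCoeff b x 0 1 k / (k + 1) * ρ ^ (k + 1), ?_, ?_⟩
  · refine (hG hρ').1.hasSum.congr_fun fun k => ?_
    simp only [mehlerCoeff, add_zero, Nat.factorial_succ]
    push_cast
    field_simp
  · have key := eq_of_hasDerivAt_zero_of_abs_lt_one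
      (f := fun t => stdGaussianCDF ((b - t * x) / √(1 - t ^ 2)) + stdGaussianPDF b *
        ∑' k : ℕ, mehlerCoeff b x 0 1 k / (k + 1) * t ^ (k + 1)) (fun t ht => ?_) hρ'
    · simp only [zero_mul, sub_zero, ne_eq, OfNat.ofNat_ne_zero, not_false_eq_true, zero_pow,
        Real.sqrt_one, div_one, Nat.add_eq_zero_iff, one_ne_zero, and_false, mul_zero, tsum_zero,
        add_zero] at key
      linarith
    · have h := (hasDerivAt_stdGaussianCDF_comp b x ht).add
        ((hG ht).2.const_mul (stdGaussianPDF b))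
      refine h.congr_deriv ?_
      rw [mehlerSeries]
      ring
end

section
/- Let φ(x) = (1/√(2π)) e^{−x²/2} and let H_k denote the k-th probabilist's Hermite polynomial. For every real r > 1 and all z, y ∈ ℝ, the series below converges and (√r/√(r − √r)) · [φ((z − y)/√(r − √r)) − φ((z + y)/√(r − √r))] = 2 φ(z/√r) · Σ_{k=0}^∞ (1/(2k+1)!) · r^{−(2k+1)/4} · H_{2k+1}(z/√r) · H_{2k+1}(y/r^{1/4}). -/
open Real Finset

open MeasureTheory

/-- The Taylor coefficient of order `n` at `t = 0` of `t ↦ exp (t * y + c * t ^ 2 / 2)`. -/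
noncomputable def expQuadraticCoeff {𝕜 : Type*} [Field 𝕜] (c y : 𝕜) (n : ℕ) : 𝕜 :=
  ∑ j ∈ range (n / 2 + 1),
    y ^ (n - 2 * j) / ((n - 2 * j).factorial : 𝕜) * ((c / 2) ^ j / (j.factorial : 𝕜))

theorem expQuadraticCoeff_scale {𝕜 : Type*} [Field 𝕜] (c y r : 𝕜) (n : ℕ) :
    expQuadraticCoeff (r ^ 2 * c) (r * y) n = r ^ n * expQuadraticCoeff c y n := by
  rw [expQuadraticCoeff, expQuadraticCoeff, mul_sum]
  refine sum_congr rfl fun j hj => ?_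
  rw [mem_range] at hj
  obtain ⟨m, rfl⟩ : ∃ m, n = m + 2 * j := ⟨n - 2 * j, by omega⟩
  rw [Nat.add_sub_cancel, mul_div_assoc, mul_pow, mul_pow, pow_add, pow_mul]
  ring

theorem hasSum_expQuadraticCoeff {𝕜 : Type*} [NormedField 𝕜] [NormedAlgebra ℚ 𝕜]
    [CompleteSpace 𝕜] (c y t : 𝕜) :
    HasSum (fun n => expQuadraticCoeff c y n * t ^ n)
      (NormedSpace.exp (t * y) * NormedSpace.exp (c * t ^ 2 / 2)) := by
  have hsummable : Summable fun p : ℕ × ℕ => (t * y) ^ p.1 / (p.1.factorial : 𝕜) *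
      ((c * t ^ 2 / 2) ^ p.2 / (p.2.factorial : 𝕜)) := by
    apply summable_mul_of_summable_norm (NormedSpace.norm_expSeries_div_summable (t * y))
      (NormedSpace.norm_expSeries_div_summable (c * t ^ 2 / 2))
  have hprod := (NormedSpace.expSeries_div_hasSum_exp (t * y)).mul
    (NormedSpace.expSeries_div_hasSum_exp (c * t ^ 2 / 2)) hsummable
  let F : ℕ × ℕ → 𝕜 := fun p => if 2 * p.2 ≤ p.1 then
    y ^ (p.1 - 2 * p.2) / ((p.1 - 2 * p.2).factorial : 𝕜) *
      ((c / 2) ^ p.2 / (p.2.factorial : 𝕜)) * t ^ p.1 else 0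
  let e : ℕ × ℕ → ℕ × ℕ := fun p => (p.1 + 2 * p.2, p.2)
  have he : Function.Injective e := by
    rintro ⟨a, b⟩ ⟨a', b'⟩ h
    simp only [e, Prod.mk.injEq] at h ⊢
    omega
  have hF : ∀ p ∉ Set.range e, F p = 0 := by
    rintro ⟨n, j⟩ hp
    refine if_neg fun h => hp ⟨(n - 2 * j, j), ?_⟩
    simp only at h
    simp only [e, Prod.mk.injEq, and_true]
    omega
  have hFe : F ∘ e = fun p : ℕ × ℕ => (t * y) ^ p.1 / (p.1.factorial : 𝕜) *
      ((c * t ^ 2 / 2) ^ p.2 / (p.2.factorial : 𝕜)) := by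
    funext p
    simp only [Function.comp_apply, F, e, le_add_iff_nonneg_left, zero_le, if_true,
      Nat.add_sub_cancel]
    rw [pow_add, pow_mul, mul_pow, mul_div_right_comm c, mul_pow]
    ring
  rw [← hFe, he.hasSum_iff hF] at hprod
  refine hprod.prod_fiberwise fun n => ?_
  have : expQuadraticCoeff c y n * t ^ n = ∑ j ∈ range (n / 2 + 1), F (n, j) := by
    rw [expQuadraticCoeff, sum_mul]
    refine sum_congr rfl fun j hj => ?_
    rw [mem_range] at hj
    exact (if_pos (by simp only; omega)).symm
  rw [this]
  refine hasSum_sum_of_ne_finset_zero fun j hj => if_neg ?_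
  rw [mem_range] at hj
  simp only
  omega

theorem hasSum_expQuadraticCoeff_real (c y t : ℝ) :
    HasSum (fun n => expQuadraticCoeff c y n * t ^ n) (Real.exp (t * y + c * t ^ 2 / 2)) := by
  rw [Real.exp_add, Real.exp_eq_exp_ℝ]
  exact hasSum_expQuadraticCoeff c y t

theorem hasSum_expQuadraticCoeff_complex (c y t : ℂ) :
    HasSum (fun n => expQuadraticCoeff c y n * t ^ n) (Complex.exp (t * y + c * t ^ 2 / 2)) := by
  rw [Complex.exp_add, Complex.exp_eq_exp_ℂ]
  exact hasSum_expQuadraticCoeff c y t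

theorem norm_expQuadraticCoeff_le (c y : ℂ) (n : ℕ) :
    ‖expQuadraticCoeff c y n‖ ≤ expQuadraticCoeff ‖c‖ ‖y‖ n := by
  refine (norm_sum_le _ _).trans (le_of_eq (sum_congr rfl fun j _ => ?_))
  simp

theorem ofReal_hermiteP (n : ℕ) (x : ℝ) :
    (hermiteP n x : ℂ) = n.factorial * expQuadraticCoeff (-1 : ℂ) x n := by
  rw [hermiteP, expQuadraticCoeff, mul_sum]
  push_cast
  refine sum_congr rfl fun j _ => ?_
  rw [div_pow]
  field_simp

theorem hermiteP_neg (n : ℕ) (x : ℝ) : hermiteP n (-x) = (-1) ^ n * hermiteP n x := by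
  rw [hermiteP, hermiteP, mul_sum]
  refine sum_congr rfl fun j hj => ?_
  rw [mem_range] at hj
  obtain ⟨m, rfl⟩ : ∃ m, n = m + 2 * j := ⟨n - 2 * j, by omega⟩
  rw [Nat.add_sub_cancel, neg_pow x, pow_add, pow_mul]
  ring

theorem integrable_exp_quadratic_abs {b : ℝ} (hb : b < 0) (c d : ℝ) :
    Integrable fun g : ℝ => Real.exp (b * g ^ 2 + c * |g| + d) := by
  have h : ∀ c : ℝ, Integrable fun g : ℝ => Real.exp (b * g ^ 2 + c * g + d) := fun c => by
    have := (integrable_cexp_quadratic' (b := (b : ℂ)) (by simpa using hb) c d).norm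
    refine this.congr (ae_of_all _ fun g => ?_)
    simp only [Complex.norm_exp]
    norm_cast
  refine ((h c).add (h (-c))).mono' (by fun_prop) (ae_of_all _ fun g => ?_)
  rw [Real.norm_eq_abs, Real.abs_exp, Pi.add_apply]
  rcases abs_choice g with hg | hg <;> rw [hg]
  · exact le_add_of_nonneg_right (Real.exp_nonneg _)
  · rw [mul_neg, neg_mul]
    exact le_add_of_nonneg_left (Real.exp_nonneg _)

/-- Termwise Gaussian integration, along a vertical line, of an entire function of order two. -/
theorem hasSum_integral_gaussian_of_norm_le {a : ℕ → ℂ} {A : ℕ → ℝ} {f : ℂ → ℂ} {p q : ℝ}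
    (hq : q < 1) (haA : ∀ n, ‖a n‖ ≤ A n)
    (hA : ∀ s, HasSum (fun n => A n * s ^ n) (Real.exp (s * p + q * s ^ 2 / 2)))
    (hf : ∀ u, HasSum (fun n => a n * u ^ n) (f u)) (x : ℝ) :
    HasSum (fun n => a n * ∫ g : ℝ, (x + g * Complex.I) ^ n * Complex.exp (-(g : ℂ) ^ 2 / 2))
      (∫ g : ℝ, f (x + g * Complex.I) * Complex.exp (-(g : ℂ) ^ 2 / 2)) := by
  simp_rw [← integral_const_mul]
  have hbound : ∀ g : ℝ, HasSum (fun n => A n * (|x| + |g|) ^ n * Real.exp (-g ^ 2 / 2))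
      (Real.exp ((q - 1) / 2 * g ^ 2 + (p + q * |x|) * |g| + (|x| * p + q * x ^ 2 / 2))) := by
    intro g
    convert! (hA (|x| + |g|)).mul_right (Real.exp (-g ^ 2 / 2)) using 1
    rw [← Real.exp_add, ← sq_abs g, ← sq_abs x]
    ring_nf
  refine hasSum_integral_of_dominated_convergence
    (fun n g => A n * (|x| + |g|) ^ n * Real.exp (-g ^ 2 / 2)) (fun n => ?_)
    (fun n => ae_of_all _ fun g => ?_) (ae_of_all _ fun g => (hbound g).summable) ?_
    (ae_of_all _ fun g => ?_)
  · exact Continuous.aestronglyMeasurable (by fun_prop)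
  · have hline : ‖(x + g * Complex.I : ℂ)‖ ≤ |x| + |g| :=
      (norm_add_le _ _).trans (by simp)
    have hweight : ‖Complex.exp (-(g : ℂ) ^ 2 / 2)‖ = Real.exp (-g ^ 2 / 2) := by
      rw [Complex.norm_exp]
      norm_cast
    rw [norm_mul, norm_mul, norm_pow, hweight, ← mul_assoc]
    have := (norm_nonneg _).trans (haA n)
    gcongr
    exact haA n
  · simp_rw [fun g => (hbound g).tsum_eq]
    exact integrable_exp_quadratic_abs (by linarith) _ _
  · simpa only [mul_assoc] using (hf (x + g * Complex.I)).mul_right (Complex.exp (-(g : ℂ) ^ 2 / 2))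

theorem integral_cexp_gaussian_line {q : ℝ} (hq : q < 1) (p : ℂ) (x : ℝ) :
    ∫ g : ℝ, Complex.exp ((x + g * Complex.I) * p - q * (x + g * Complex.I) ^ 2 / 2) *
        Complex.exp (-(g : ℂ) ^ 2 / 2) =
      (√(2 * π / (1 - q)) : ℝ) *
        Complex.exp ((2 * x * p - p ^ 2 - q * x ^ 2) / (2 * (1 - q))) := by
  have hq' : (1 - q : ℂ) ≠ 0 := by
    exact_mod_cast (sub_pos.2 hq).ne'
  have key := integral_cexp_quadratic (b := ((-(1 - q) / 2 : ℝ) : ℂ))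
    (by rw [Complex.ofReal_re]; linarith) (Complex.I * (p - q * x)) (x * p - q * x ^ 2 / 2)
  convert! key using 1
  · refine integral_congr_ae (ae_of_all _ fun g => ?_)
    simp only [← Complex.exp_add]
    congr 1
    push_cast
    linear_combination (-(q : ℂ) * g ^ 2 / 2) * Complex.I_sq
  · congr 1
    · rw [Real.sqrt_eq_rpow, Complex.ofReal_cpow (by have := sub_pos.2 hq; positivity)]
      push_cast
      congr 1
      field_simp
    · congr 1
      push_cast
      rw [mul_pow, Complex.I_sq]
      have : (q - 1 : ℂ) ≠ 0 := by rw [← neg_sub]; exact neg_ne_zero.2 hq'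
      field_simp
      ring

theorem integral_pow_gaussian_line (n : ℕ) (x : ℝ) :
    ∫ g : ℝ, (x + g * Complex.I) ^ n * Complex.exp (-(g : ℂ) ^ 2 / 2) =
      (√(2 * π) : ℝ) * hermiteP n x := by
  set m : ℕ → ℂ := fun n => ∫ g : ℝ, (x + g * Complex.I) ^ n * Complex.exp (-(g : ℂ) ^ 2 / 2)
  have hsum : ∀ t : ℂ, HasSum (fun n => t ^ n • (m n / n.factorial))
      ((√(2 * π) : ℝ) * Complex.exp (t * x + (-1) * t ^ 2 / 2)) := by
    intro t
    have h := hasSum_integral_gaussian_of_norm_le (a := expQuadraticCoeff (0 : ℂ) t)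
      (A := expQuadraticCoeff (0 : ℝ) ‖t‖) (p := ‖t‖) zero_lt_one
      (by simpa using norm_expQuadraticCoeff_le 0 t)
      (hasSum_expQuadraticCoeff_real 0 ‖t‖) (hasSum_expQuadraticCoeff_complex 0 t) x
    have hintegral := integral_cexp_gaussian_line zero_lt_one t x
    simp only [Complex.ofReal_zero, zero_mul, zero_div, sub_zero, add_zero, div_one,
      mul_one] at h hintegral
    rw [hintegral] at h
    convert! h using 2 with n
    · have : expQuadraticCoeff 0 t n = t ^ n / n.factorial := by
        rw [expQuadraticCoeff, sum_range_succ']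
        simp
      rw [this, smul_eq_mul]
      ring
    · congr 1
      ring
  have hsum' : ∀ t : ℂ, HasSum
      (fun n => t ^ n • ((√(2 * π) : ℝ) * expQuadraticCoeff (-1 : ℂ) x n))
      ((√(2 * π) : ℝ) * Complex.exp (t * x + (-1) * t ^ 2 / 2)) := by
    intro t
    convert! (hasSum_expQuadraticCoeff_complex (-1) x t).mul_left _ using 2 with n
    rw [smul_eq_mul]
    ring
  have hseries : ∀ {a : ℕ → ℂ} {f : ℂ → ℂ}, (∀ t, HasSum (fun n => t ^ n • a n) (f t)) →
      HasFPowerSeriesAt f (FormalMultilinearSeries.ofScalars ℂ a) 0 := fun h =>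
    hasFPowerSeriesAt_iff.2 <| Filter.Eventually.of_forall fun t => by
      simpa only [FormalMultilinearSeries.coeff_ofScalars, zero_add] using h t
  have hcoeff := congrArg (fun p => FormalMultilinearSeries.coeff p n)
    ((hseries hsum).eq_formalMultilinearSeries (hseries hsum'))
  simp only [FormalMultilinearSeries.coeff_ofScalars] at hcoeff
  rw [div_eq_iff (by exact_mod_cast n.factorial_ne_zero)] at hcoeff
  change m n = _
  rw [ofReal_hermiteP, hcoeff]
  ring

/-- Mehler's formula. -/
theorem hasSum_mehler {ρ : ℝ} (hρ : |ρ| < 1) (x y : ℝ) :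
    HasSum (fun n : ℕ => ρ ^ n / n.factorial * hermiteP n x * hermiteP n y)
      (1 / √(1 - ρ ^ 2) *
        Real.exp ((2 * ρ * x * y - ρ ^ 2 * (x ^ 2 + y ^ 2)) / (2 * (1 - ρ ^ 2)))) := by
  have hρ' : ρ ^ 2 < 1 := (sq_lt_one_iff_abs_lt_one ρ).2 hρ
  have hnorm : ∀ n, ‖expQuadraticCoeff ((ρ : ℂ) ^ 2 * (-1)) ((ρ : ℂ) * y) n‖ ≤
      expQuadraticCoeff (ρ ^ 2) |ρ * y| n := fun n => by
    convert! norm_expQuadraticCoeff_le ((ρ : ℂ) ^ 2 * (-1)) (ρ * y) n using 2 <;> simp [abs_mul]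
  have h := hasSum_integral_gaussian_of_norm_le
    hρ' hnorm
    (hasSum_expQuadraticCoeff_real _ _) (hasSum_expQuadraticCoeff_complex _ _) x
  have hintegral := integral_cexp_gaussian_line hρ' (ρ * y) x
  simp_rw [integral_pow_gaussian_line, expQuadraticCoeff_scale] at h
  have hexp : ∀ u : ℂ, u * (ρ * y) + (ρ : ℂ) ^ 2 * (-1) * u ^ 2 / 2 =
      u * (ρ * y) - (ρ ^ 2 : ℝ) * u ^ 2 / 2 := fun u => by push_cast; ring
  simp_rw [hexp, hintegral] at h
  have hpi : (√(2 * π) : ℂ) ≠ 0 := by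
    exact_mod_cast (Real.sqrt_pos.2 (by positivity)).ne'
  rw [← Complex.hasSum_ofReal]
  convert! h.mul_left (√(2 * π) : ℂ)⁻¹ using 1
  · funext n
    have hfact : (n.factorial : ℂ) ≠ 0 := by exact_mod_cast n.factorial_ne_zero
    push_cast
    rw [ofReal_hermiteP n y]
    field_simp
  · rw [Real.sqrt_div (by positivity)]
    push_cast
    rw [← mul_assoc, mul_div_assoc', inv_mul_cancel₀ hpi]
    congr 2
    ring

theorem hasSum_mehler_odd {ρ : ℝ} (hρ : |ρ| < 1) (x y : ℝ) :
    HasSum (fun k : ℕ => 1 / ((2 * k + 1).factorial : ℝ) * ρ ^ (2 * k + 1) *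
        hermiteP (2 * k + 1) x * hermiteP (2 * k + 1) y)
      (1 / 2 * (1 / √(1 - ρ ^ 2) *
        Real.exp ((2 * ρ * x * y - ρ ^ 2 * (x ^ 2 + y ^ 2)) / (2 * (1 - ρ ^ 2))) -
       1 / √(1 - ρ ^ 2) *
        Real.exp ((-2 * ρ * x * y - ρ ^ 2 * (x ^ 2 + y ^ 2)) / (2 * (1 - ρ ^ 2))))) := by
  have h := ((hasSum_mehler hρ x y).sub (hasSum_mehler hρ x (-y))).mul_left (1 / 2)
  have hinj : Function.Injective fun k : ℕ => 2 * k + 1 := fun a b hab => by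
    simp only at hab
    omega
  rw [← hinj.hasSum_iff] at h
  · convert! h using 1
    · funext k
      simp only [Function.comp_apply, hermiteP_neg, (odd_two_mul_add_one k).neg_one_pow]
      ring
    · simp only [neg_sq, mul_neg, neg_mul]
  · intro n hn
    have : Even n := by
      rw [← Nat.not_odd_iff_even]
      rintro ⟨k, rfl⟩
      exact hn ⟨k, rfl⟩
    rw [hermiteP_neg, this.neg_one_pow]
    ring

/-- For `r > 1` and `z, y ∈ ℝ`, the series
`Σ_{k=0}^∞ (1/(2k+1)!) r^{−(2k+1)/4} H_{2k+1}(z/√r) H_{2k+1}(y/r^{1/4})` converges, with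
sum `S` satisfying
`(√r/√(r−√r)) [φ((z−y)/√(r−√r)) − φ((z+y)/√(r−√r))] = 2 φ(z/√r) S`. -/
theorem gaussianPDF_difference_expansion (r : ℝ) (hr : 1 < r) (z y : ℝ) :
    ∃ S : ℝ,
      HasSum (fun k : ℕ =>
        (1 / ((2 * k + 1).factorial : ℝ)) * r ^ (-(2 * (k : ℝ) + 1) / 4) *
          hermiteP (2 * k + 1) (z / Real.sqrt r) *
          hermiteP (2 * k + 1) (y / r ^ ((1 : ℝ) / 4))) S ∧
      (Real.sqrt r / Real.sqrt (r - Real.sqrt r)) *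
          (stdGaussianPDF ((z - y) / Real.sqrt (r - Real.sqrt r)) -
            stdGaussianPDF ((z + y) / Real.sqrt (r - Real.sqrt r))) =
        2 * stdGaussianPDF (z / Real.sqrt r) * S := by
  obtain ⟨q, hq, rfl⟩ : ∃ q : ℝ, 1 < q ∧ r = q ^ 4 :=
    ⟨r ^ ((1 : ℝ) / 4), Real.one_lt_rpow hr (by norm_num), by
      rw [← Real.rpow_natCast, ← Real.rpow_mul (by linarith)]; norm_num⟩
  have hq0 : 0 < q := by linarith
  have hroot : (q ^ 4) ^ ((1 : ℝ) / 4) = q := by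
    rw [← Real.rpow_natCast, ← Real.rpow_mul hq0.le]; norm_num
  have hsqrt : √(q ^ 4) = q ^ 2 := by
    rw [show q ^ 4 = (q ^ 2) ^ 2 by ring, Real.sqrt_sq (by positivity)]
  have hpow : ∀ k : ℕ, (q ^ 4) ^ (-(2 * (k : ℝ) + 1) / 4) = q⁻¹ ^ (2 * k + 1) := fun k => by
    rw [← Real.rpow_natCast, ← Real.rpow_mul hq0.le, inv_pow, ← Real.rpow_natCast,
      ← Real.rpow_neg hq0.le]
    congr 1
    push_cast
    ring
  have hρ : |q⁻¹| < 1 := by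
    rw [abs_of_pos (by positivity)]
    exact inv_lt_one_of_one_lt₀ hq
  simp_rw [hpow, hroot, hsqrt]
  refine ⟨_, hasSum_mehler_odd hρ _ _, ?_⟩
  have hd : 0 < q ^ 2 - 1 := by nlinarith
  have hd' : 0 < q ^ 4 - q ^ 2 := by nlinarith [mul_pos (pow_pos hq0 2) hd]
  have hsd : √(q ^ 4 - q ^ 2) = q ^ 2 * √(1 - q⁻¹ ^ 2) := by
    rw [show q ^ 4 - q ^ 2 = (q ^ 2) ^ 2 * (1 - q⁻¹ ^ 2) by field_simp,
      Real.sqrt_mul (by positivity), Real.sqrt_sq (by positivity)]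
  have hcoef : q ^ 2 / √(q ^ 4 - q ^ 2) = 1 / √(1 - q⁻¹ ^ 2) := by
    rw [hsd, div_mul_cancel_left₀ (by positivity), one_div]
  have hexp : ∀ s : ℝ, Real.exp (-((z - s) / √(q ^ 4 - q ^ 2)) ^ 2 / 2) =
      Real.exp (-(z / q ^ 2) ^ 2 / 2) * Real.exp ((2 * q⁻¹ * (z / q ^ 2) * (s / q) -
        q⁻¹ ^ 2 * ((z / q ^ 2) ^ 2 + (s / q) ^ 2)) / (2 * (1 - q⁻¹ ^ 2))) := fun s => by
    rw [← Real.exp_add, div_pow, Real.sq_sqrt hd'.le,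
      show q ^ 4 - q ^ 2 = q ^ 2 * (q ^ 2 - 1) by ring,
      show 1 - q⁻¹ ^ 2 = (q ^ 2 - 1) / q ^ 2 by field_simp]
    congr 1
    have := hd.ne'
    field_simp
    ring
  have hadd := hexp (-y)
  rw [sub_neg_eq_add, neg_div q, neg_sq, mul_neg, ← neg_mul, ← neg_mul, ← neg_mul] at hadd
  simp only [stdGaussianPDF]
  rw [hcoef, hexp y, hadd]
  ring
end
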